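/- For every a ∈ (0,1/2], the function y ↦ log(μ_a^{-1}(y)) is concave on (0,∞); that is, μ_a^{-1} is log-concave. In particular, for all p, q, x, y > 0 with p + q = 1: (μ_a^{-1}(x))^p · (μ_a^{-1}(y))^q ≤ μ_a^{-1}(p x + q y). -/

import Mathlib

open Real Set

/-- Shifted factorial (Pochhammer/Appell symbol) `(a)ₙ`. -/
noncomputable def shiftedFact (a : ℝ) : ℕ → ℝ
  | 0 => 1
  | n + 1 => shiftedFact a n * (a + n)

/-- Gaussian hypergeometric function `F(a,b;c;x)` as a series. -/
noncomputable def hypF (a b c x : ℝ) : ℝ :=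
  ∑' n : ℕ, shiftedFact a n * shiftedFact b n / (shiftedFact c n * (Nat.factorial n : ℝ)) * x ^ n

/-- Generalized complete elliptic integral of the first kind `𝒦ₐ(r)`. -/
noncomputable def ellK (a r : ℝ) : ℝ := (Real.pi / 2) * hypF a (1 - a) 1 (r ^ 2)

/-- Generalized complete elliptic integral of the second kind `ℰₐ(r)`. -/
noncomputable def ellE (a r : ℝ) : ℝ := (Real.pi / 2) * hypF (a - 1) (1 - a) 1 (r ^ 2)

/-- The generalized Grötzsch modulus `μₐ(r)`. -/
noncomputable def muFn (a r : ℝ) : ℝ :=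
  Real.pi / (2 * Real.sin (Real.pi * a)) * ellK a (Real.sqrt (1 - r ^ 2)) / ellK a r

/-- Inverse of `μₐ` (on `(0,1)`, where it is a decreasing homeomorphism onto `(0,∞)`). -/
noncomputable def muInv (a : ℝ) : ℝ → ℝ := Function.invFunOn (muFn a) (Set.Ioo 0 1)

/-- The generalized modular function `φ_K^a(r)`. -/
noncomputable def phiK (a K r : ℝ) : ℝ := muInv a (muFn a r / K)

/-- `η_K^a(x) = (s/s')²` where `s = φ_K^a(√(x/(1+x)))`. -/
noncomputable def etaK (a K x : ℝ) : ℝ :=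
  ((phiK a K (Real.sqrt (x / (1 + x)))) / Real.sqrt (1 - (phiK a K (Real.sqrt (x / (1 + x)))) ^ 2)) ^ 2

/-- `λₐ(K)`. -/
noncomputable def lambdaA (a K : ℝ) : ℝ :=
  (phiK a K (1 / Real.sqrt 2) / phiK a (1 / K) (1 / Real.sqrt 2)) ^ 2

/-- The generalized inverse hyperbolic tangent `artanh_p`. -/
noncomputable def artanhp (p x : ℝ) : ℝ := ∫ t in (0:ℝ)..x, (1 - t ^ p)⁻¹

/-- The inverse hyperbolic tangent. -/
noncomputable def artanh (x : ℝ) : ℝ := (1 / 2) * Real.log ((1 + x) / (1 - x))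

/-- Euler beta function. -/
noncomputable def betaB (x y : ℝ) : ℝ := Real.Gamma x * Real.Gamma y / Real.Gamma (x + y)

/-- `μ_{a,c}(r)`, the two-parameter generalized modulus. -/
noncomputable def muAC (a c r : ℝ) : ℝ :=
  betaB a (c - a) * hypF a (c - a) c (1 - r ^ 2) / (2 * hypF a (c - a) c (r ^ 2))

/-- Inverse of `μ_{a,c}` on `(0,1)`. -/
noncomputable def muACInv (a c : ℝ) : ℝ → ℝ := Function.invFunOn (muAC a c) (Set.Ioo 0 1)

/-- The modular function `φ_K^{a,c}(r)`. -/
noncomputable def phiAC (a c K r : ℝ) : ℝ := muACInv a c (muAC a c r / K)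

noncomputable def cc (a : ℝ) (n : ℕ) : ℝ :=
  shiftedFact a n * shiftedFact (1 - a) n / (shiftedFact 1 n * (Nat.factorial n : ℝ))

noncomputable def qq (a x : ℝ) : ℝ := ∑' n : ℕ, cc a n / (n + 1) * x ^ n

theorem ps_summable {c : ℕ → ℝ} (hc : ∀ n, |c n| ≤ 1) {x : ℝ} (hx : |x| < 1) :
    Summable (fun n => c n * x ^ n) := by
  refine Summable.of_norm_bounded (summable_geometric_of_lt_one (abs_nonneg x) hx) fun n => ?_
  rw [norm_mul, norm_pow, Real.norm_eq_abs, Real.norm_eq_abs]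
  exact mul_le_of_le_one_left (by positivity) (hc n)

theorem ps_deriv {c : ℕ → ℝ} (hc : ∀ n, |c n| ≤ 1) {x : ℝ} (hx : |x| < 1) :
    ∃ S, HasSum (fun n : ℕ => ((n : ℝ) + 1) * c (n + 1) * x ^ n) S ∧
      HasDerivAt (fun z => ∑' n : ℕ, c n * z ^ n) S x := by
  obtain ⟨r, hxr, hr1⟩ := exists_between hx
  have hr0 : 0 < r := lt_of_le_of_lt (abs_nonneg x) hxr
  have hu : Summable (fun n : ℕ => (n : ℝ) * r ^ (n - 1)) := by
    have h := (summable_pow_mul_geometric_of_norm_lt_one (R := ℝ) 1 (r := r)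
      (by rw [Real.norm_eq_abs, abs_of_pos hr0]; exact hr1)).mul_left r⁻¹
    refine h.congr fun n => ?_
    rcases n with _ | n
    · simp
    · simp only [Nat.add_sub_cancel, pow_succ, pow_zero]; field_simp
  have hb : ∀ (n : ℕ) (y : ℝ), y ∈ Metric.ball (0:ℝ) r →
      ‖c n * ((n : ℝ) * y ^ (n - 1))‖ ≤ (n : ℝ) * r ^ (n - 1) := by
    intro n y hy
    have hy' : |y| < r := by simpa using hy
    rw [norm_mul, norm_mul, norm_pow, Real.norm_eq_abs, Real.norm_eq_abs, Real.norm_eq_abs]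
    rw [abs_of_nonneg (Nat.cast_nonneg n : (0:ℝ) ≤ n)]
    have : |y| ^ (n-1) ≤ r ^ (n-1) := pow_le_pow_left₀ (abs_nonneg y) hy'.le _
    calc |c n| * ((n:ℝ) * |y| ^ (n-1)) ≤ (n:ℝ) * |y| ^ (n-1) :=
          mul_le_of_le_one_left (by positivity) (hc n)
      _ ≤ _ := by gcongr
  have hxm : x ∈ Metric.ball (0:ℝ) r := by simpa using hxr
  have hd := hasDerivAt_tsum_of_isPreconnected (g := fun (n:ℕ) z => c n * z ^ n)
    (g' := fun n y => c n * ((n : ℝ) * y ^ (n - 1))) hu Metric.isOpen_ball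
    (convex_ball (0:ℝ) r).isPreconnected
    (fun n y _ => (hasDerivAt_pow n y).const_mul (c n)) hb hxm (ps_summable hc hx) hxm
  refine ⟨_, ?_, hd⟩
  have hs : Summable (fun n : ℕ => c n * ((n : ℝ) * x ^ (n - 1))) :=
    Summable.of_norm_bounded hu fun n => hb n x hxm
  have h2 := (hasSum_nat_add_iff' 1).2 hs.hasSum
  simp only [Finset.range_one, Finset.sum_singleton, Nat.cast_zero, zero_mul, mul_zero,
    sub_zero] at h2
  convert! h2 using 2 with n
  rw [Nat.add_sub_cancel]; push_cast; ring

theorem cc_zero (a : ℝ) : cc a 0 = 1 := by simp [cc, shiftedFact]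

theorem sf_one (n : ℕ) : shiftedFact 1 n = (Nat.factorial n : ℝ) := by
  induction n with
  | zero => simp [shiftedFact]
  | succ n ih => rw [shiftedFact, ih, Nat.factorial_succ]; push_cast; ring

theorem cc_succ (a : ℝ) (n : ℕ) :
    cc a (n+1) * ((n:ℝ)+1)^2 = cc a n * ((n:ℝ) * (n+1) + a * (1-a)) := by
  have h : (Nat.factorial n : ℝ) ≠ 0 := by positivity
  have h1 : (n:ℝ) + 1 ≠ 0 := by positivity
  simp only [cc, sf_one, shiftedFact, Nat.factorial_succ]
  push_cast
  field_simp
  ring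

theorem cc_pos {a : ℝ} (h0 : 0 < a) (h1 : a < 1) (n : ℕ) : 0 < cc a n := by
  have hab : 0 < a * (1-a) := mul_pos h0 (by linarith)
  induction n with
  | zero => rw [cc_zero]; norm_num
  | succ n ih =>
    have h := cc_succ a n
    have : 0 < cc a n * ((n:ℝ) * (n+1) + a * (1-a)) := by positivity
    rw [← h] at this
    exact pos_of_mul_pos_left this (by positivity)

theorem cc_le {a : ℝ} (h0 : 0 < a) (h1 : a < 1) (n : ℕ) : cc a n ≤ 1 := by
  induction n with
  | zero => rw [cc_zero]
  | succ n ih =>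
    have h := cc_succ a n
    have hp := cc_pos h0 h1 n
    have hq : a * (1-a) ≤ 1 := by nlinarith
    have hn : (0:ℝ) ≤ n := Nat.cast_nonneg n
    by_contra hcon
    push Not at hcon
    have : cc a n * ((n:ℝ) * (n+1) + a * (1-a)) ≤ 1 * ((n:ℝ)+1)^2 := by
      have : 0 < a * (1-a) := mul_pos h0 (by linarith)
      apply mul_le_mul ih _ (by positivity) (by norm_num)
      nlinarith
    have : 1 * ((n:ℝ)+1)^2 < cc a (n+1) * ((n:ℝ)+1)^2 := by
      apply mul_lt_mul_of_pos_right hcon (by positivity)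
    linarith

theorem cc_abs {a : ℝ} (h0 : 0 < a) (h1 : a < 1) (n : ℕ) : |cc a n| ≤ 1 := by
  rw [abs_of_pos (cc_pos h0 h1 n)]; exact cc_le h0 h1 n

theorem cc_lower {a : ℝ} (h0 : 0 < a) (h1 : a < 1) (n : ℕ) :
    a * (1-a) ≤ ((n:ℝ)+1) * cc a (n+1) := by
  induction n with
  | zero => have := cc_succ a 0; rw [cc_zero] at this; norm_num at this ⊢; linarith
  | succ n ih =>
    have h := cc_succ a (n+1)
    have hp := cc_pos h0 h1 (n+1)
    have hab : 0 < a * (1-a) := mul_pos h0 (by linarith)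
    push_cast at h ⊢
    have hn : (0:ℝ) ≤ n := Nat.cast_nonneg n
    have h2 : ((n:ℝ)+1+1) * cc a (n+1+1) * ((n:ℝ)+1+1) =
      ((n:ℝ)+1) * cc a (n+1) * ((n:ℝ)+1+1) + cc a (n+1) * (a * (1-a)) := by linarith
    have h3 : 0 < cc a (n+1) * (a * (1-a)) := by positivity
    by_contra hcon
    push Not at hcon
    have : ((n:ℝ)+1+1) * cc a (n+1+1) * ((n:ℝ)+1+1) < ((n:ℝ)+1) * cc a (n+1) * ((n:ℝ)+1+1) :=
      mul_lt_mul_of_pos_right (by linarith) (by positivity)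
    linarith

theorem hyp_eq (a x : ℝ) : hypF a (1-a) 1 x = ∑' n : ℕ, cc a n * x ^ n := rfl

theorem hyp_hasSum {a x : ℝ} (h0 : 0 < a) (h1 : a < 1) (hx : |x| < 1) :
    HasSum (fun n : ℕ => cc a n * x ^ n) (hypF a (1-a) 1 x) :=
  (ps_summable (cc_abs h0 h1) hx).hasSum

theorem cq_abs {a : ℝ} (h0 : 0 < a) (h1 : a < 1) (n : ℕ) : |cc a n / (n+1)| ≤ 1 := by
  have hn : (0:ℝ) ≤ n := Nat.cast_nonneg n
  have := cc_pos h0 h1 n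
  have := cc_le h0 h1 n
  rw [abs_of_nonneg (by positivity), div_le_one (by positivity)]
  linarith

theorem qq_hasSum {a x : ℝ} (h0 : 0 < a) (h1 : a < 1) (hx : |x| < 1) :
    HasSum (fun n : ℕ => cc a n / (n+1) * x ^ n) (qq a x) :=
  (ps_summable (cq_abs h0 h1) hx).hasSum

theorem hyp_deriv {a x : ℝ} (h0 : 0 < a) (h1 : a < 1) (hx : |x| < 1) :
    HasDerivAt (hypF a (1-a) 1) (a * (1-a) * qq a x / (1 - x)) x := by
  obtain ⟨S, hS, hd⟩ := ps_deriv (cc_abs h0 h1) hx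
  have e : S * (1 - x) = a * (1-a) * qq a x := by
    have h2 : HasSum (fun n : ℕ => (n:ℝ) * cc a n * x ^ n) (x * S) := by
      refine (hasSum_nat_add_iff' 1).1 ?_
      simp only [Finset.range_one, Finset.sum_singleton, Nat.cast_zero, zero_mul, sub_zero]
      convert! hS.mul_left x using 2 with n
      push_cast; ring
    have h3 := hS.sub h2
    have h4 := (qq_hasSum h0 h1 hx).mul_left (a * (1-a))
    have h5 := h3.unique (by
      convert! h4 using 2 with n
      have h := cc_succ a n
      have hn : (n:ℝ) + 1 ≠ 0 := by positivity
      field_simp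
      linear_combination x ^ n * h)
    linarith
  have h1x : 1 - x ≠ 0 := by have := (abs_lt.1 hx).2; linarith
  rw [← e, mul_div_assoc, div_self h1x, mul_one]
  exact hd

theorem xq_deriv {a x : ℝ} (h0 : 0 < a) (h1 : a < 1) (hx : |x| < 1) :
    HasDerivAt (fun z => z * qq a z) (hypF a (1-a) 1 x) x := by
  set d : ℕ → ℝ := fun n => match n with
    | 0 => 0
    | n+1 => cc a n / (n+1) with hdd
  have hdabs : ∀ n, |d n| ≤ 1 := by
    intro n
    rcases n with _ | n
    · simp [hdd]
    · exact cq_abs h0 h1 n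
  obtain ⟨S, hS, hd⟩ := ps_deriv hdabs hx
  have e : S = hypF a (1-a) 1 x := by
    refine hS.unique ?_
    convert hyp_hasSum h0 h1 hx using 2 with n
    have hn : (n:ℝ) + 1 ≠ 0 := by positivity
    simp only [hdd]
    field_simp
  rw [← e]
  refine hd.congr_of_eventuallyEq ?_
  have : ∀ᶠ z in nhds x, |z| < 1 :=
    (continuous_abs.isOpen_preimage _ isOpen_Iio).mem_nhds hx
  filter_upwards [this] with z hz
  have h2 : HasSum (fun n : ℕ => d n * z ^ n) (z * qq a z) := by
    refine (hasSum_nat_add_iff' 1).1 ?_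
    simp only [Finset.range_one, Finset.sum_singleton, hdd, zero_mul, sub_zero]
    convert! (qq_hasSum h0 h1 hz).mul_left z using 2 with n
    ring
  exact h2.tsum_eq.symm

theorem abs_of_Ioo {x : ℝ} (h : x ∈ Ioo (0:ℝ) 1) : |x| < 1 := by
  rw [abs_of_pos h.1]; exact h.2

theorem one_sub_Ioo {x : ℝ} (h : x ∈ Ioo (0:ℝ) 1) : 1 - x ∈ Ioo (0:ℝ) 1 :=
  ⟨by linarith [h.2], by linarith [h.1]⟩

theorem qq_pos {a x : ℝ} (h0 : 0 < a) (h1 : a < 1) (hx : x ∈ Ioo (0:ℝ) 1) : 0 < qq a x := by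
  have h := qq_hasSum h0 h1 (abs_of_Ioo hx)
  have hx0 := hx.1
  have := h.summable.tsum_pos (fun n => by
    have := cc_pos h0 h1 n
    positivity) 0 (by simp [cc_zero])
  exact this

theorem qq_le {a x : ℝ} (h0 : 0 < a) (h1 : a < 1) (hx : x ∈ Ioo (0:ℝ) 1) :
    qq a x ≤ hypF a (1-a) 1 x := by
  refine hasSum_le (fun n => ?_) (qq_hasSum h0 h1 (abs_of_Ioo hx)) (hyp_hasSum h0 h1 (abs_of_Ioo hx))
  have hp := cc_pos h0 h1 n
  have hx0 := hx.1
  have hn : (0:ℝ) ≤ n := Nat.cast_nonneg n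
  have : cc a n / (n+1) ≤ cc a n := div_le_self hp.le (by linarith)
  gcongr

theorem hyp_pos {a x : ℝ} (h0 : 0 < a) (h1 : a < 1) (hx : x ∈ Ioo (0:ℝ) 1) :
    0 < hypF a (1-a) 1 x := (qq_pos h0 h1 hx).trans_le (qq_le h0 h1 hx)

theorem hyp_mono {a x y : ℝ} (h0 : 0 < a) (h1 : a < 1) (hx : x ∈ Ioo (0:ℝ) 1)
    (hy : y ∈ Ioo (0:ℝ) 1) (hxy : x ≤ y) : hypF a (1-a) 1 x ≤ hypF a (1-a) 1 y := by
  refine hasSum_le (fun n => ?_) (hyp_hasSum h0 h1 (abs_of_Ioo hx)) (hyp_hasSum h0 h1 (abs_of_Ioo hy))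
  have hp := cc_pos h0 h1 n
  have hx0 := hx.1
  gcongr

theorem hyp_log {a x : ℝ} (h0 : 0 < a) (h1 : a < 1) (hx : x ∈ Ioo (0:ℝ) 1) :
    a * (1-a) * (- Real.log (1-x)) ≤ hypF a (1-a) 1 x := by
  have hs := (hasSum_pow_div_log_of_abs_lt_one (abs_of_Ioo hx)).mul_left (a * (1-a))
  have h2 := (hasSum_nat_add_iff' 1).2 (hyp_hasSum h0 h1 (abs_of_Ioo hx))
  simp only [Finset.range_one, Finset.sum_singleton, cc_zero, pow_zero, mul_one] at h2
  have h3 := hasSum_le (fun n => by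
    have hl := cc_lower h0 h1 n
    have hx0 := hx.1
    have hn : (0:ℝ) < n + 1 := by positivity
    have : a * (1-a) / (n+1) ≤ cc a (n+1) := by rw [div_le_iff₀ hn]; linarith
    calc a * (1-a) * (x ^ (n+1) / (n+1)) = a * (1-a) / (n+1) * x ^ (n+1) := by ring
      _ ≤ cc a (n+1) * x ^ (n+1) := by gcongr) hs h2
  linarith

noncomputable def VV (a x : ℝ) : ℝ :=
  (1-x) * qq a (1-x) * hypF a (1-a) 1 x + x * qq a x * hypF a (1-a) 1 (1-x)

theorem VV_deriv {a x : ℝ} (h0 : 0 < a) (h1 : a < 1) (hx : x ∈ Ioo (0:ℝ) 1) :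
    HasDerivAt (VV a) 0 x := by
  have hx' := one_sub_Ioo hx
  have hs : HasDerivAt (fun z : ℝ => 1 - z) (-1) x := by
    simpa using (hasDerivAt_id x).const_sub 1
  have f1 := hyp_deriv h0 h1 (abs_of_Ioo hx)
  have f2 := (hyp_deriv h0 h1 (abs_of_Ioo hx')).comp x hs
  have q1 := xq_deriv h0 h1 (abs_of_Ioo hx)
  have q2 := HasDerivAt.comp (h₂ := fun z => z * qq a z) x (xq_deriv h0 h1 (abs_of_Ioo hx')) hs
  have h := (q2.mul f1).add (q1.mul f2)
  have hx0 : x ≠ 0 := hx.1.ne'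
  have hx1 : 1 - x ≠ 0 := hx'.1.ne'
  convert! h using 1
  simp only [Function.comp]
  have : 1 - (1 - x) = x := by ring
  rw [this]
  field_simp
  ring

theorem VV_const {a : ℝ} (h0 : 0 < a) (h1 : a < 1) {x : ℝ} (hx : x ∈ Ioo (0:ℝ) 1) :
    VV a x = VV a (1/2) := by
  have hh : (1/2:ℝ) ∈ Ioo (0:ℝ) 1 := by constructor <;> norm_num
  refine isOpen_Ioo.is_const_of_deriv_eq_zero isPreconnected_Ioo
    (fun y hy => (VV_deriv h0 h1 hy).differentiableAt.differentiableWithinAt)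
    (fun y hy => (VV_deriv h0 h1 hy).deriv) hx hh

theorem VV_pos {a : ℝ} (h0 : 0 < a) (h1 : a < 1) : 0 < VV a (1/2) := by
  have hh : (1/2:ℝ) ∈ Ioo (0:ℝ) 1 := by constructor <;> norm_num
  have := qq_pos h0 h1 hh
  have := hyp_pos h0 h1 hh
  rw [VV, show (1:ℝ) - 1/2 = 1/2 by norm_num]
  positivity

noncomputable def RR (a x : ℝ) : ℝ := hypF a (1-a) 1 (1-x) / hypF a (1-a) 1 x

theorem RR_deriv {a x : ℝ} (h0 : 0 < a) (h1 : a < 1) (hx : x ∈ Ioo (0:ℝ) 1) :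
    HasDerivAt (RR a) (-(a * (1-a) * VV a (1/2)) / (x * ((1-x) * hypF a (1-a) 1 x ^ 2))) x := by
  have hx' := one_sub_Ioo hx
  have hs : HasDerivAt (fun z : ℝ => 1 - z) (-1) x := by
    simpa using (hasDerivAt_id x).const_sub 1
  have f1 := hyp_deriv h0 h1 (abs_of_Ioo hx)
  have f2 := (hyp_deriv h0 h1 (abs_of_Ioo hx')).comp x hs
  have hp := (hyp_pos h0 h1 hx).ne'
  have h := f2.div f1 hp
  rw [← VV_const h0 h1 hx, VV]
  have hx0 : x ≠ 0 := hx.1.ne'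
  have hx1 : 1 - x ≠ 0 := hx'.1.ne'
  convert! h using 1
  simp only [Function.comp]
  have : 1 - (1 - x) = x := by ring
  rw [this]
  field_simp
  ring

theorem G_anti {a : ℝ} (h0 : 0 < a) (h1 : a < 1) :
    AntitoneOn (fun x => (1-x) * hypF a (1-a) 1 x ^ 2) (Ioo (0:ℝ) 1) := by
  have hd : ∀ x ∈ Ioo (0:ℝ) 1, HasDerivAt (fun x => (1-x) * hypF a (1-a) 1 x ^ 2)
      (hypF a (1-a) 1 x * (2 * (a * (1-a)) * qq a x - hypF a (1-a) 1 x)) x := by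
    intro x hx
    have hs : HasDerivAt (fun z : ℝ => 1 - z) (-1) x := by
      simpa using (hasDerivAt_id x).const_sub 1
    have h := hs.mul ((hyp_deriv h0 h1 (abs_of_Ioo hx)).pow 2)
    have hx1 : 1 - x ≠ 0 := (one_sub_Ioo hx).1.ne'
    convert! h using 1
    simp only [Pi.pow_apply]
    field_simp
    ring
  refine antitoneOn_of_deriv_nonpos (convex_Ioo 0 1)
    (fun x hx => (hd x hx).continuousAt.continuousWithinAt) ?_ ?_
  · rw [interior_Ioo]
    exact fun x hx => (hd x hx).differentiableAt.differentiableWithinAt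
  · rw [interior_Ioo]
    intro x hx
    rw [(hd x hx).deriv]
    have hq := qq_pos h0 h1 hx
    have hl := qq_le h0 h1 hx
    have hp := hyp_pos h0 h1 hx
    have hab : 2 * (a * (1-a)) ≤ 1 := by nlinarith [sq_nonneg (2*a-1)]
    refine mul_nonpos_of_nonneg_of_nonpos hp.le ?_
    nlinarith

theorem mu_eq {a r : ℝ} (hr : r ∈ Ioo (0:ℝ) 1) :
    muFn a r = Real.pi / (2 * Real.sin (Real.pi * a)) * RR a (r^2) := by
  have : 0 ≤ 1 - r^2 := by nlinarith [hr.1, hr.2]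
  rw [muFn, ellK, ellK, RR, Real.sq_sqrt this]
  have := Real.pi_pos.ne'
  rw [mul_div_assoc, mul_div_mul_left _ _ (by positivity)]

theorem RR_large {a : ℝ} (h0 : 0 < a) (h1 : a < 1) (Y : ℝ) :
    ∃ x ∈ Ioo (0:ℝ) 1, Y ≤ RR a x := by
  have hh : (1/2:ℝ) ∈ Ioo (0:ℝ) 1 := by constructor <;> norm_num
  have hH := hyp_pos h0 h1 hh
  have hab : 0 < a * (1-a) := mul_pos h0 (by linarith)
  set H := hypF a (1-a) 1 (1/2) with hHd
  set s := max 1 (Y * H / (a * (1-a))) with hs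
  have s1 : 1 ≤ s := le_max_left _ _
  have s2 : Y * H ≤ s * (a * (1-a)) := (div_le_iff₀ hab).1 (le_max_right _ _)
  have hx2 : Real.exp (-s) ≤ 1/2 := by
    have : 2 ≤ Real.exp s := by have := Real.add_one_le_exp s; linarith
    rw [Real.exp_neg, one_div]
    exact inv_anti₀ (by norm_num) this
  have hx : Real.exp (-s) ∈ Ioo (0:ℝ) 1 := ⟨Real.exp_pos _, by linarith⟩
  refine ⟨_, hx, ?_⟩
  have hlog := hyp_log h0 h1 (one_sub_Ioo hx)
  have e : 1 - (1 - Real.exp (-s)) = Real.exp (-s) := by ring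
  rw [e, Real.log_exp, neg_neg] at hlog
  have hm := hyp_mono h0 h1 hx hh hx2
  have hp := hyp_pos h0 h1 hx
  rw [RR, le_div_iff₀ hp]
  rcases le_total Y 0 with hY | hY
  · have := mul_nonpos_of_nonpos_of_nonneg hY hp.le
    have := hyp_pos h0 h1 (one_sub_Ioo hx)
    linarith
  · have := mul_le_mul_of_nonneg_left hm hY
    linarith

theorem RR_surj {a : ℝ} (h0 : 0 < a) (h1 : a < 1) {Y : ℝ} (hY : 0 < Y) :
    ∃ x ∈ Ioo (0:ℝ) 1, RR a x = Y := by
  obtain ⟨x1, hx1, h1'⟩ := RR_large h0 h1 Y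
  obtain ⟨x2, hx2, h2'⟩ := RR_large h0 h1 Y⁻¹
  have hx2' := one_sub_Ioo hx2
  have h3 : RR a (1 - x2) ≤ Y := by
    have : RR a (1 - x2) = (RR a x2)⁻¹ := by
      rw [RR, RR, inv_div, show 1 - (1 - x2) = x2 by ring]
    rw [this]
    exact inv_le_of_inv_le₀ hY h2'
  have hc : ContinuousOn (RR a) (Ioo 0 1) := fun x hx =>
    (RR_deriv h0 h1 hx).continuousAt.continuousWithinAt
  exact isPreconnected_Ioo.intermediate_value hx2' hx1 hc ⟨h3, h1'⟩

noncomputable def hh (a t : ℝ) : ℝ :=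
  Real.pi / (2 * Real.sin (Real.pi * a)) * RR a (Real.exp (2 * t))

theorem exp_Ioo {t : ℝ} (ht : t < 0) : Real.exp (2*t) ∈ Ioo (0:ℝ) 1 :=
  ⟨Real.exp_pos _, by rw [Real.exp_lt_one_iff]; linarith⟩

theorem hh_deriv {a t : ℝ} (h0 : 0 < a) (h1 : a < 1) (ht : t < 0) :
    HasDerivAt (hh a) (-(Real.pi / (2 * Real.sin (Real.pi * a)) * (2 * (a * (1-a) * VV a (1/2)))) /
      ((1-Real.exp (2*t)) * hypF a (1-a) 1 (Real.exp (2*t)) ^ 2)) t := by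
  have hx := exp_Ioo ht
  have hs : HasDerivAt (fun z : ℝ => Real.exp (2*z)) (Real.exp (2*t) * 2) t := by
    simpa using ((hasDerivAt_id t).const_mul 2).exp
  have h := (HasDerivAt.comp (h₂ := RR a) t (RR_deriv h0 h1 hx) hs).const_mul
    (Real.pi / (2 * Real.sin (Real.pi * a)))
  have hx0 := hx.1.ne'
  have hx1 := (one_sub_Ioo hx).1.ne'
  have hp := (hyp_pos h0 h1 hx).ne'
  convert! h using 1
  generalize Real.pi / (2 * Real.sin (Real.pi * a)) = C
  field_simp

theorem C_pos {a : ℝ} (h0 : 0 < a) (h1 : a < 1) :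
    0 < Real.pi / (2 * Real.sin (Real.pi * a)) := by
  have hp := Real.pi_pos
  have : 0 < Real.sin (Real.pi * a) := Real.sin_pos_of_pos_of_lt_pi (by positivity) (by nlinarith)
  positivity

theorem hh_den {a t : ℝ} (h0 : 0 < a) (h1 : a < 1) (ht : t < 0) :
    0 < (1-Real.exp (2*t)) * hypF a (1-a) 1 (Real.exp (2*t)) ^ 2 := by
  have hx := exp_Ioo ht
  have := (one_sub_Ioo hx).1
  have := hyp_pos h0 h1 hx
  positivity

theorem hh_num {a : ℝ} (h0 : 0 < a) (h1 : a < 1) :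
    0 < Real.pi / (2 * Real.sin (Real.pi * a)) * (2 * (a * (1-a) * VV a (1/2))) := by
  have := C_pos h0 h1
  have := VV_pos h0 h1
  have hab : 0 < a * (1-a) := mul_pos h0 (by linarith)
  positivity

theorem hh_anti {a : ℝ} (h0 : 0 < a) (h1 : a < 1) : StrictAntiOn (hh a) (Iio 0) := by
  refine strictAntiOn_of_deriv_neg (convex_Iio 0)
    (fun t ht => (hh_deriv h0 h1 ht).continuousAt.continuousWithinAt) ?_
  rw [interior_Iio]
  intro t ht
  rw [(hh_deriv h0 h1 ht).deriv]
  exact div_neg_of_neg_of_pos (neg_neg_of_pos (hh_num h0 h1)) (hh_den h0 h1 ht)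

theorem hh_concave {a : ℝ} (h0 : 0 < a) (h1 : a < 1) : ConcaveOn ℝ (Iio 0) (hh a) := by
  refine AntitoneOn.concaveOn_of_deriv (convex_Iio 0)
    (fun t ht => (hh_deriv h0 h1 ht).continuousAt.continuousWithinAt) ?_ ?_
  · rw [interior_Iio]
    exact fun t ht => (hh_deriv h0 h1 ht).differentiableAt.differentiableWithinAt
  · rw [interior_Iio]
    intro s hs t ht hst
    rw [(hh_deriv h0 h1 ht).deriv, (hh_deriv h0 h1 hs).deriv, neg_div, neg_div, neg_le_neg_iff]
    refine div_le_div_of_nonneg_left (hh_num h0 h1).le (hh_den h0 h1 ht) ?_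
    exact G_anti h0 h1 (exp_Ioo hs) (exp_Ioo ht) (Real.exp_le_exp.2 (by linarith))

theorem mu_hh {a r : ℝ} (hr : r ∈ Ioo (0:ℝ) 1) : muFn a r = hh a (Real.log r) := by
  rw [mu_eq hr, hh, two_mul (Real.log r), Real.exp_add, Real.exp_log hr.1, pow_two]

theorem muInv_spec {a y : ℝ} (h0 : 0 < a) (h1 : a < 1) (hy : 0 < y) :
    muInv a y ∈ Ioo (0:ℝ) 1 ∧ muFn a (muInv a y) = y := by
  have hC := C_pos h0 h1
  obtain ⟨x, hx, hxe⟩ := RR_surj h0 h1 (div_pos hy hC)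
  have hr : Real.sqrt x ∈ Ioo (0:ℝ) 1 :=
    ⟨Real.sqrt_pos.2 hx.1, by rw [Real.sqrt_lt' one_pos]; simpa using hx.2⟩
  have hex : ∃ r ∈ Ioo (0:ℝ) 1, muFn a r = y := by
    refine ⟨_, hr, ?_⟩
    rw [mu_eq hr, Real.sq_sqrt hx.1.le, hxe, mul_div_cancel₀ _ hC.ne']
  exact ⟨Function.invFunOn_mem hex, Function.invFunOn_eq hex⟩

theorem main_concave {a : ℝ} (h0 : 0 < a) (h1 : a < 1) :
    ConcaveOn ℝ (Set.Ioi 0) (fun y : ℝ => Real.log (muInv a y)) := by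
  refine ⟨convex_Ioi 0, ?_⟩
  intro x hx y hy p q hp hq hpq
  have hz : p • x + q • y ∈ Ioi (0:ℝ) := convex_Ioi 0 hx hy hp hq hpq
  obtain ⟨mx, ex⟩ := muInv_spec h0 h1 hx
  obtain ⟨my, ey⟩ := muInv_spec h0 h1 hy
  obtain ⟨mz, ez⟩ := muInv_spec h0 h1 hz
  rw [mu_hh mx] at ex
  rw [mu_hh my] at ey
  rw [mu_hh mz] at ez
  have lx : Real.log (muInv a x) ∈ Iio (0:ℝ) := Real.log_neg mx.1 mx.2
  have ly : Real.log (muInv a y) ∈ Iio (0:ℝ) := Real.log_neg my.1 my.2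
  have lz : Real.log (muInv a (p • x + q • y)) ∈ Iio (0:ℝ) := Real.log_neg mz.1 mz.2
  have hc := (hh_concave h0 h1).2 lx ly hp hq hpq
  rw [ex, ey] at hc
  nth_rewrite 1 [← ez] at hc
  exact ((hh_anti h0 h1).le_iff_ge lz (convex_Iio 0 lx ly hp hq hpq)).1 hc

theorem stmt6 (a : ℝ) (ha : a ∈ Set.Ioc (0:ℝ) (1/2)) :
    ConcaveOn ℝ (Set.Ioi 0) (fun y : ℝ => Real.log (muInv a y)) ∧
    ∀ p q x y : ℝ, 0 < p → 0 < q → 0 < x → 0 < y → p + q = 1 →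
      (muInv a x) ^ p * (muInv a y) ^ q ≤ muInv a (p * x + q * y) := by
  have h0 : 0 < a := ha.1
  have h1 : a < 1 := by linarith [ha.2]
  have hcon := main_concave h0 h1
  refine ⟨hcon, ?_⟩
  intro p q x y hp hq hx hy hpq
  have hz : 0 < p * x + q * y := by positivity
  have mx := (muInv_spec h0 h1 hx).1
  have my := (muInv_spec h0 h1 hy).1
  have mz := (muInv_spec h0 h1 hz).1
  have h := hcon.2 hx hy hp.le hq.le hpq
  simp only [smul_eq_mul] at h
  rw [← Real.log_le_log_iff (mul_pos (Real.rpow_pos_of_pos mx.1 _) (Real.rpow_pos_of_pos my.1 _)) mz.1,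
    Real.log_mul (Real.rpow_pos_of_pos mx.1 _).ne' (Real.rpow_pos_of_pos my.1 _).ne',
    Real.log_rpow mx.1, Real.log_rpow my.1]
  exact h
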